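/- Let R be a commutative ring, A a commutative unital R-algebra, and suppose Δ = δ₁ ∘ δ₂ ∘ ⋯ ∘ δ_k is a composition of k ≥ 1 R-derivations δ₁,…,δ_k of A. Then the Koszul hierarchy of Δ terminates at the k-th place: Φⁿ_Δ(a₁,…,a_n) = 0 for every n ≥ k + 1 and all a₁,…,a_n ∈ A. -/

import Mathlib

/-- The nested-commutator operator `[⋯[[Δ, m_{a₁}], m_{a₂}]⋯, m_{a_n}]`, where
`m_a` is multiplication by `a` and `[·,·]` is the commutator of endomorphisms. -/
def koszulOp {R A : Type*} [CommRing R] [CommRing A] [Algebra R A]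
    (Δ : Module.End R A) (l : List A) : Module.End R A :=
  l.foldl (fun D a => ⁅D, LinearMap.mulLeft R a⁆) Δ

/-- The Koszul hierarchy of higher derived brackets of an `R`-linear map `Δ : A → A`:
`Φⁿ_Δ(a₁,…,a_n) = [⋯[[Δ, m_{a₁}], m_{a₂}]⋯, m_{a_n}](1)`. -/
def koszulBracket {R A : Type*} [CommRing R] [CommRing A] [Algebra R A]
    (Δ : Module.End R A) (l : List A) : A :=
  koszulOp Δ l 1

section koszulOp

variable {R A : Type*} [CommRing R] [CommRing A] [Algebra R A]

lemma koszulOp_cons (D : Module.End R A) (a : A) (l : List A) :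
    koszulOp D (a :: l) = koszulOp ⁅D, LinearMap.mulLeft R a⁆ l := rfl

lemma koszulOp_zero (l : List A) : koszulOp (0 : Module.End R A) l = 0 := by
  induction l with
  | nil => rfl
  | cons a l ih => rw [koszulOp_cons, Ring.lie_def, zero_mul, mul_zero, sub_zero, ih]

lemma koszulOp_add (D E : Module.End R A) (l : List A) :
    koszulOp (D + E) l = koszulOp D l + koszulOp E l := by
  induction l generalizing D E with
  | nil => rfl
  | cons a l ih =>
    simp only [koszulOp_cons, Ring.lie_def, add_mul, mul_add, add_sub_add_comm, ih]

lemma koszulOp_mulLeft_mul (b : A) (D : Module.End R A) (l : List A) :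
    koszulOp (LinearMap.mulLeft R b * D) l = LinearMap.mulLeft R b * koszulOp D l := by
  induction l generalizing D with
  | nil => rfl
  | cons a l ih =>
    have h : ⁅LinearMap.mulLeft R b * D, LinearMap.mulLeft R a⁆ =
        LinearMap.mulLeft R b * ⁅D, LinearMap.mulLeft R a⁆ := by
      ext x
      simp only [Ring.lie_def, LinearMap.sub_apply, Module.End.mul_apply,
        LinearMap.mulLeft_apply]
      ring
    rw [koszulOp_cons, h, ih, koszulOp_cons]

lemma derivation_mul_lie_mulLeft (d : Derivation R A A) (D : Module.End R A) (a : A) :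
    ⁅(d : Module.End R A) * D, LinearMap.mulLeft R a⁆ =
      (d : Module.End R A) * ⁅D, LinearMap.mulLeft R a⁆ + LinearMap.mulLeft R (d a) * D := by
  ext x
  simp only [Ring.lie_def, LinearMap.sub_apply, LinearMap.add_apply, Module.End.mul_apply,
    LinearMap.mulLeft_apply, Derivation.coeFn_coe, map_sub, Derivation.leibniz, smul_eq_mul]
  ring

/-- Composing with a derivation on the left raises the order of a differential operator
by at most one. -/
lemma koszulOp_derivation_mul_eq_zero (d : Derivation R A A) {n : ℕ} {D : Module.End R A}
    (hD : ∀ l : List A, n ≤ l.length → koszulOp D l = 0) (l : List A)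
    (hl : n + 1 ≤ l.length) : koszulOp ((d : Module.End R A) * D) l = 0 := by
  induction n generalizing D l with
  | zero =>
    have h : D = 0 := hD [] le_rfl
    rw [h, mul_zero, koszulOp_zero]
  | succ n ih =>
    cases l with
    | nil => simp at hl
    | cons a l =>
      have hl' : n + 1 ≤ l.length := by simpa using hl
      rw [koszulOp_cons, derivation_mul_lie_mulLeft, koszulOp_add, koszulOp_mulLeft_mul,
        hD l hl', mul_zero, add_zero]
      exact ih (fun l' h => hD (a :: l') (by simpa using h)) l hl'

/-- A composition of `k` derivations is a differential operator of order at most `k`. -/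
lemma koszulOp_prod_derivations_eq_zero (L : List (Derivation R A A)) (l : List A)
    (hl : L.length + 1 ≤ l.length) :
    koszulOp (L.map (fun d : Derivation R A A => (d : Module.End R A))).prod l = 0 := by
  induction L generalizing l with
  | nil =>
    cases l with
    | nil => simp at hl
    | cons a l =>
      rw [koszulOp_cons, List.map_nil, List.prod_nil, Ring.lie_def, one_mul, mul_one, sub_self,
        koszulOp_zero]
  | cons d L ih =>
    rw [List.map_cons, List.prod_cons]
    exact koszulOp_derivation_mul_eq_zero d ih l hl

end koszulOp

/-- If `Δ = δ₁ ∘ δ₂ ∘ ⋯ ∘ δ_k` is a composition of `k ≥ 1`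
`R`-derivations of `A`, then the Koszul hierarchy of `Δ` terminates at the `k`-th place:
`Φⁿ_Δ = 0` for every `n ≥ k + 1`. -/
theorem koszulBracket_vanish_of_comp_derivations
    {R A : Type*} [CommRing R] [CommRing A] [Algebra R A]
    (k : ℕ) (hk : 1 ≤ k) (δ : Fin k → Derivation R A A)
    (Δ : Module.End R A)
    (hΔ : Δ = (List.ofFn (fun i => (δ i : Module.End R A))).prod)
    (n : ℕ) (hn : k + 1 ≤ n) (a : Fin n → A) :
    koszulBracket Δ (List.ofFn a) = 0 := by
  have h := koszulOp_prod_derivations_eq_zero (List.ofFn δ) (List.ofFn a) (by simpa using hn)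
  rw [List.map_ofFn] at h
  subst hΔ
  exact LinearMap.congr_fun h 1
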